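/- arXiv:1404.3030 — 3 statements merged into one kernel-verified Lean document; each statement's English description precedes it below -/
import Mathlib

section
/- Let G be a group, σ : G → G an involutive group automorphism (σ ∘ σ = id), H a subgroup of G, and a ∈ G an element such that σ(H) = aHa⁻¹. Let μ : G/H → G/H be the well-defined map with μ(gH) = (σ(g)·a)H. Then μ is an involution (μ ∘ μ = id on G/H) if and only if σ(a)·a ∈ H. -/
/-- With `σ` an involutive automorphism of `G`, `H ≤ G` and `a ∈ G`
such that `σ(H) = aHa⁻¹`, let `μ : G/H → G/H` be the well-defined map with
`μ(gH) = (σ(g)·a)H`. Then `μ` is an involution if and only if `σ(a)·a ∈ H`. -/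
theorem stmt4 (G : Type*) [Group G] (σ : G ≃* G) (hσ : ∀ g : G, σ (σ g) = g)
    (H : Subgroup G) (a : G)
    (ha : H.map σ.toMonoidHom = H.map (MulAut.conj a).toMonoidHom)
    (μ : G ⧸ H → G ⧸ H)
    (hμ : ∀ g : G, μ (g : G ⧸ H) = ((σ g * a : G) : G ⧸ H)) :
    (∀ x : G ⧸ H, μ (μ x) = x) ↔ σ a * a ∈ H := by
  have key : ∀ g : G, μ (μ (g : G ⧸ H)) = (g : G ⧸ H) ↔ σ a * a ∈ H := by
    intro g
    rw [hμ, hμ, map_mul, hσ, eq_comm, QuotientGroup.eq, mul_assoc, inv_mul_cancel_left]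
  constructor
  · intro h
    exact (key 1).1 (h _)
  · intro h x
    obtain ⟨g, rfl⟩ := QuotientGroup.mk_surjective x
    exact (key g).2 h
end

section
/- Let G be a group, σ : G → G an involutive group automorphism (σ ∘ σ = id), and H a subgroup of G. If there exists a σ-equivariant involution μ : G/H → G/H (that is, μ ∘ μ = id and μ(g • x) = σ(g) • μ(x) for all g ∈ G, x ∈ G/H), then the subgroups σ(H) and H are conjugate in G: there exists b ∈ G with σ(H) = bHb⁻¹. -/
/-- Let `σ` be an involutive group automorphism of `G` and `H ≤ G`.
If there exists a `σ`-equivariant involution `μ : G/H → G/H`, then the subgroups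
`σ(H)` and `H` are conjugate in `G`: there exists `b ∈ G` with `σ(H) = bHb⁻¹`. -/
theorem stmt8 (G : Type*) [Group G] (σ : G ≃* G) (hσ : ∀ g : G, σ (σ g) = g)
    (H : Subgroup G)
    (hexists : ∃ μ : G ⧸ H → G ⧸ H,
      (∀ x : G ⧸ H, μ (μ x) = x) ∧
      (∀ (g : G) (x : G ⧸ H), μ (g • x) = σ g • μ x)) :
    ∃ b : G, H.map σ.toMonoidHom = H.map (MulAut.conj b).toMonoidHom := by
  obtain ⟨μ, hinv, heq⟩ := hexists
  obtain ⟨b, hb⟩ := QuotientGroup.mk_surjective (μ ((1 : G) : G ⧸ H))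
  have key : ∀ g : G, g ∈ H ↔ b⁻¹ * σ g * b ∈ H := by
    intro g
    have h1 : g ∈ H ↔ g • ((1 : G) : G ⧸ H) = ((1 : G) : G ⧸ H) := by
      rw [MulAction.Quotient.smul_coe, eq_comm, QuotientGroup.eq]
      simp
    have h2 : b⁻¹ * σ g * b ∈ H ↔ σ g • (b : G ⧸ H) = (b : G ⧸ H) := by
      rw [MulAction.Quotient.smul_coe, eq_comm, QuotientGroup.eq]
      simp [mul_assoc]
    have hμ : Function.Injective μ := Function.LeftInverse.injective hinv
    rw [h1, h2, hb, ← heq, hμ.eq_iff]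
  refine ⟨b, ?_⟩
  ext x
  constructor
  · rintro ⟨g, hg, rfl⟩
    exact ⟨b⁻¹ * σ g * b, (key g).1 hg, by simp [mul_assoc]⟩
  · rintro ⟨h, hh, rfl⟩
    refine ⟨σ (b * h * b⁻¹), (key _).2 ?_, ?_⟩
    · rw [hσ]
      simpa [mul_assoc] using hh
    · simpa using hσ (b * h * b⁻¹)
end

section
/- Let G be a group, P a subgroup of G, σ : G → G a group automorphism, and n ∈ G with σ(P) = nPn⁻¹. Let X' be a set with a left P-action, let μ' : X' → X' satisfy μ'(p • x) = (n⁻¹·σ(p)·n) • μ'(x) for all p ∈ P and x ∈ X', and let μ be the induced map on the balanced product G ×_P X' given by μ([g, x]) = [σ(g)·n, μ'(x)]. If μ has a fixed point in G ×_P X', then the well-defined map G/P → G/P, gP ↦ (σ(g)·n)P has a fixed point in G/P. -/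
/-- The relation on `G × X'` whose generated equivalence defines the balanced product
(parabolic induction) `G ×_P X'`: `(g, x) ∼ (g·p, p⁻¹ • x)` for `p ∈ P`. -/
def indRel (G : Type*) [Group G] (P : Subgroup G) (X' : Type*) [MulAction P X'] :
    G × X' → G × X' → Prop :=
  fun a b => ∃ p : P, b.1 = a.1 * p ∧ b.2 = p⁻¹ • a.2

/-- Let `P ≤ G`, `σ` a group automorphism of `G`, and `n ∈ G` with
`σ(P) = nPn⁻¹`. Let `X'` be a `P`-set, `μ' : X' → X'` satisfy
`μ'(p • x) = (n⁻¹·σ(p)·n) • μ'(x)`, and let `μ` be the induced map on `G ×_P X'`,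
`μ([g, x]) = [σ(g)·n, μ'(x)]`. If `μ` has a fixed point in `G ×_P X'`, then the
well-defined map `G/P → G/P`, `gP ↦ (σ(g)·n)P` has a fixed point in `G/P`. -/
theorem stmt12 (G : Type*) [Group G] (P : Subgroup G) (X' : Type*) [MulAction P X']
    (σ : G ≃* G) (n : G)
    (hP : P.map σ.toMonoidHom = P.map (MulAut.conj n).toMonoidHom)
    (μ' : X' → X')
    (hμ' : ∀ p q : P, (q : G) = n⁻¹ * σ p * n → ∀ x : X', μ' (p • x) = q • μ' x)
    (μ : Quot (indRel G P X') → Quot (indRel G P X'))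
    (hμ : ∀ (g : G) (x : X'),
      μ (Quot.mk (indRel G P X') (g, x)) = Quot.mk (indRel G P X') (σ g * n, μ' x))
    (hfix : ∃ y : Quot (indRel G P X'), μ y = y) :
    ∃ ν : G ⧸ P → G ⧸ P,
      (∀ g : G, ν (g : G ⧸ P) = ((σ g * n : G) : G ⧸ P)) ∧
      (∃ z : G ⧸ P, ν z = z) := by
  have key : ∀ p : G, p ∈ P → n⁻¹ * σ p * n ∈ P := by
    intro p hp
    have h : σ p ∈ P.map (MulAut.conj n).toMonoidHom := by
      rw [← hP]
      exact ⟨p, hp, rfl⟩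
    obtain ⟨q, hq, hqe⟩ := h
    have h2 : n * q * n⁻¹ = σ p := hqe
    have h3 : n⁻¹ * σ p * n = q := by
      rw [← h2]; group
    rw [h3]; exact hq
  have wd : ∀ a b : G, (QuotientGroup.leftRel P) a b →
      ((σ a * n : G) : G ⧸ P) = ((σ b * n : G) : G ⧸ P) := by
    intro a b hab
    rw [QuotientGroup.leftRel_apply] at hab
    rw [QuotientGroup.eq]
    have h := key _ hab
    have e : (σ a * n)⁻¹ * (σ b * n) = n⁻¹ * σ (a⁻¹ * b) * n := by
      rw [map_mul, map_inv]; group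
    rw [e]; exact h
  refine ⟨Quotient.lift (fun g : G => ((σ g * n : G) : G ⧸ P)) wd, fun g => rfl, ?_⟩
  obtain ⟨y, hy⟩ := hfix
  obtain ⟨⟨g, x⟩, rfl⟩ := Quot.exists_rep y
  rw [hμ] at hy
  let π : Quot (indRel G P X') → G ⧸ P := Quot.lift (fun a => ((a.1 : G) : G ⧸ P)) (by
    rintro a b ⟨p, h1, -⟩
    change ((a.1 : G) : G ⧸ P) = ((b.1 : G) : G ⧸ P)
    rw [QuotientGroup.eq, h1, inv_mul_cancel_left]
    exact p.2)
  exact ⟨(g : G ⧸ P), congrArg π hy⟩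
end
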